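/- arXiv:2512.01758 — 3 statements merged into one kernel-verified Lean document; each statement's English description precedes it below -/
import Mathlib

section
/- Let Σ be a real symmetric 2m×2m matrix and Ω = ⊕_{k=1}^m ω with ω = [[0,1],[-1,0]]. If the complex Hermitian matrix Σ + iΩ is positive semidefinite, then Σ is positive definite. -/
open Matrix
open scoped ComplexOrder

/-- The 2×2 standard symplectic form ω = [[0,1],[-1,0]]. -/
def omega2 : Matrix (Fin 2) (Fin 2) ℝ := !![0, 1; -1, 0]

/-- The 2m×2m symplectic form Ω = ⊕_{k=1}^m ω. -/
def Omega (m : ℕ) : Matrix (Fin 2 × Fin m) (Fin 2 × Fin m) ℝ :=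
  Matrix.blockDiagonal fun _ : Fin m => omega2

/-- The quadratic form of the complex matrix `A + iB` at `x + iy`, in real coordinates. -/
theorem Matrix.PosSemidef.real_form_nonneg {n : Type*} [Fintype n] {A B : Matrix n n ℝ}
    (h : (A.map Complex.ofReal + Complex.I • B.map Complex.ofReal).PosSemidef) (x y : n → ℝ) :
    0 ≤ x ⬝ᵥ A *ᵥ x + y ⬝ᵥ A *ᵥ y - x ⬝ᵥ B *ᵥ y + y ⬝ᵥ B *ᵥ x := by
  have hre := (Complex.le_def.1
    (h.dotProduct_mulVec_nonneg fun i => (x i : ℂ) + (y i : ℂ) * Complex.I)).1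
  simp only [dotProduct, mulVec, Finset.mul_sum, Complex.re_sum, ← Finset.sum_add_distrib,
    ← Finset.sum_sub_distrib, Complex.zero_re] at hre ⊢
  refine hre.trans_eq (Finset.sum_congr rfl fun i _ => Finset.sum_congr rfl fun j _ => ?_)
  simp
  ring

theorem Omega_mul_transpose (m : ℕ) : Omega m * (Omega m)ᵀ = 1 := by
  have h : omega2 * omega2ᵀ = 1 := by
    ext i j
    fin_cases i <;> fin_cases j <;> simp [omega2, Matrix.mul_apply]
  rw [Omega, blockDiagonal_transpose, ← blockDiagonal_mul]
  simp only [h]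
  exact blockDiagonal_one

theorem Omega_transpose (m : ℕ) : (Omega m)ᵀ = -Omega m := by
  have h : omega2ᵀ = -omega2 := by
    ext i j
    fin_cases i <;> fin_cases j <;> simp [omega2]
  rw [Omega, blockDiagonal_transpose, ← blockDiagonal_neg]
  simp only [h]
  rfl

/-- If Σ is real symmetric and the Hermitian matrix Σ + iΩ is positive
semidefinite (Robertson–Schrödinger relation), then Σ is positive definite. -/
theorem posDef_of_uncertainty (m : ℕ)
    (Cov : Matrix (Fin 2 × Fin m) (Fin 2 × Fin m) ℝ) (hCov : Cov.IsSymm)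
    (h : (Cov.map Complex.ofReal + Complex.I • (Omega m).map Complex.ofReal).PosSemidef) :
    Cov.PosDef := by
  have hN : ∀ x : Fin 2 × Fin m → ℝ, x ⬝ᵥ Omega m *ᵥ (Omega m)ᵀ *ᵥ x = x ⬝ᵥ x := fun x => by
    rw [mulVec_mulVec, Omega_mul_transpose, one_mulVec]
  refine PosDef.of_dotProduct_mulVec_pos (by simpa [IsHermitian] using hCov.eq) fun x hx => ?_
  rw [star_trivial]
  have hpos : 0 < x ⬝ᵥ x := by simpa using dotProduct_star_self_pos_iff.2 hx
  set w := (Omega m)ᵀ *ᵥ x with hw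
  have hwx : w ⬝ᵥ Omega m *ᵥ x = -(x ⬝ᵥ x) := by
    rw [← hN x, ← hw, dotProduct_mulVec, ← mulVec_transpose, dotProduct_comm, Omega_transpose,
      neg_mulVec, dotProduct_neg]
  have key (t : ℝ) : 0 ≤ x ⬝ᵥ Cov *ᵥ x + t * (t * (w ⬝ᵥ Cov *ᵥ w)) - 2 * t * (x ⬝ᵥ x) := by
    have := h.real_form_nonneg x (t • w)
    simp only [mulVec_smul, dotProduct_smul, smul_dotProduct, smul_eq_mul, hwx, hw ▸ hN x] at this
    linarith
  by_contra! hle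
  have hc : 0 < w ⬝ᵥ Cov *ᵥ w := by linarith [key 1]
  have := key ((x ⬝ᵥ x) / (w ⬝ᵥ Cov *ᵥ w))
  rw [div_mul_cancel₀ _ hc.ne'] at this
  have : 0 < (x ⬝ᵥ x) / (w ⬝ᵥ Cov *ᵥ w) * (x ⬝ᵥ x) := by positivity
  linarith
end

section
/- Let Σ be a real symmetric 4×4 matrix written in 2×2 blocks as Σ = [[γ_A, γ_AB],[γ_ABᵀ, γ_B]], let Ω = ω ⊕ ω with ω = [[0,1],[-1,0]], and set Δ = det γ_A + det γ_B + 2 det γ_AB. If the complex Hermitian matrix Σ + iΩ is positive semidefinite, then det Σ ≥ 1 and Δ ≤ 1 + det Σ. -/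
open Matrix
open scoped ComplexOrder

/-- The 4×4 symplectic form Ω = ω ⊕ ω for two bosonic modes. -/
def Omega4 : Matrix (Fin 2 ⊕ Fin 2) (Fin 2 ⊕ Fin 2) ℝ :=
  Matrix.fromBlocks omega2 0 0 omega2

namespace Matrix

variable {n 𝕜 : Type*} [Fintype n] [DecidableEq n] [RCLike 𝕜]

theorem IsHermitian.norm_det_le_one {M : Matrix n n 𝕜} (hM : M.IsHermitian)
    (hadd : (1 + M).PosSemidef) (hsub : (1 - M).PosSemidef) : ‖M.det‖ ≤ 1 := by
  rw [hM.det_eq_prod_eigenvalues, norm_prod]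
  refine Finset.prod_le_one (fun _ _ => norm_nonneg _) fun i _ => ?_
  have hv : RCLike.re (star ⇑(hM.eigenvectorBasis i) ⬝ᵥ ⇑(hM.eigenvectorBasis i)) = 1 := by
    rw [dotProduct_comm, ← EuclideanSpace.inner_eq_star_dotProduct]
    simp
  have h₁ := hadd.re_dotProduct_nonneg (hM.eigenvectorBasis i)
  have h₂ := hsub.re_dotProduct_nonneg (hM.eigenvectorBasis i)
  rw [add_mulVec, one_mulVec, dotProduct_add, map_add, hv, ← hM.eigenvalues_eq] at h₁
  rw [sub_mulVec, one_mulVec, dotProduct_sub, map_sub, hv, ← hM.eigenvalues_eq] at h₂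
  rw [RCLike.norm_ofReal, abs_le]
  constructor <;> linarith

theorem posDef_of_posSemidef_add_of_posSemidef_sub {P H : Matrix n n 𝕜} (hP : P.IsHermitian)
    (hH : IsUnit H) (hadd : (P + H).PosSemidef) (hsub : (P - H).PosSemidef) : P.PosDef := by
  have key (x : n → 𝕜) : star x ⬝ᵥ (P + H) *ᵥ x + star x ⬝ᵥ (P - H) *ᵥ x =
      2 * (star x ⬝ᵥ P *ᵥ x) := by
    rw [add_mulVec, sub_mulVec, dotProduct_add, dotProduct_sub]
    ring
  refine PosDef.of_dotProduct_mulVec_pos hP fun x hx => ?_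
  have h₁ := hadd.dotProduct_mulVec_nonneg x
  have h₂ := hsub.dotProduct_mulVec_nonneg x
  have h₀ : 0 ≤ 2 * (star x ⬝ᵥ P *ᵥ x) := key x ▸ add_nonneg h₁ h₂
  have h₃ : 0 ≤ star x ⬝ᵥ P *ᵥ x := by
    have h2 : (0 : 𝕜) ≤ ((2⁻¹ : ℝ) : 𝕜) := RCLike.ofReal_nonneg.mpr (by norm_num)
    have h4 := mul_nonneg h2 h₀
    rwa [← mul_assoc, RCLike.ofReal_inv, RCLike.ofReal_ofNat, inv_mul_cancel₀ two_ne_zero,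
      one_mul] at h4
  refine lt_of_le_of_ne h₃ fun h => hx ?_
  have hsum := key x
  rw [← h, mul_zero, add_eq_zero_iff_of_nonneg h₁ h₂, hadd.dotProduct_mulVec_zero_iff,
    hsub.dotProduct_mulVec_zero_iff, add_mulVec, sub_mulVec] at hsum
  have hPH : P *ᵥ x = H *ᵥ x := sub_eq_zero.mp hsum.2
  have hHx : H *ᵥ x = 0 := by
    have := hsum.1
    rwa [hPH, ← two_smul 𝕜, smul_eq_zero_iff_right two_ne_zero] at this
  exact mulVec_injective_of_isUnit hH (by rw [hHx, mulVec_zero])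

section

open scoped MatrixOrder Matrix.Norms.L2Operator

theorem PosDef.norm_det_le {P H : Matrix n n 𝕜} (hP : P.PosDef) (hH : H.IsHermitian)
    (hadd : (P + H).PosSemidef) (hsub : (P - H).PosSemidef) : ‖H.det‖ ≤ ‖P.det‖ := by
  obtain ⟨B, hB, rfl⟩ := CStarAlgebra.isStrictlyPositive_iff_eq_star_mul_self.mp
    hP.isStrictlyPositive
  lift B to (Matrix n n 𝕜)ˣ using hB
  set C : Matrix n n 𝕜 := ↑B⁻¹ with hC
  have hBC : (B : Matrix n n 𝕜) * C = 1 := B.mul_inv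
  have hCB : Cᴴ * (star (B : Matrix n n 𝕜) * B) * C = 1 := by
    rw [star_eq_conjTranspose, Matrix.mul_assoc, Matrix.mul_assoc, hBC, Matrix.mul_one,
      ← conjTranspose_mul, hBC, conjTranspose_one]
  have h₁ := hadd.conjTranspose_mul_mul_same C
  have h₂ := hsub.conjTranspose_mul_mul_same C
  rw [Matrix.mul_add, Matrix.add_mul, hCB] at h₁
  rw [Matrix.mul_sub, Matrix.sub_mul, hCB] at h₂
  have h := (isHermitian_conjTranspose_mul_mul C hH).norm_det_le_one h₁ h₂
  have hdet := congrArg (fun A => ‖A.det‖) hCB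
  simp only [det_mul, norm_mul, det_one, norm_one] at h hdet ⊢
  have hc : 0 < ‖Cᴴ.det‖ * ‖C.det‖ := by
    refine lt_of_le_of_ne (by positivity) fun h0 => ?_
    rw [mul_right_comm, ← h0, zero_mul] at hdet
    exact zero_ne_one hdet
  refine le_of_mul_le_mul_left ?_ hc
  linarith

end

end Matrix

theorem det_Omega4 : Omega4.det = 1 := by
  simp [Omega4, omega2, det_fin_two]

theorem transpose_Omega4 : Omega4ᵀ = -Omega4 := by
  simp only [Omega4, fromBlocks_transpose, fromBlocks_neg, omega2]
  congr 1 <;> ext i j <;> fin_cases i <;> fin_cases j <;> simp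

/-- The uncertainty relation for a covariance matrix forces its determinant to be at least one. -/
theorem one_le_det_of_posSemidef {S : Matrix (Fin 2 ⊕ Fin 2) (Fin 2 ⊕ Fin 2) ℝ} (hS : S.IsSymm)
    (h : (S.map Complex.ofReal + Complex.I • Omega4.map Complex.ofReal).PosSemidef) :
    1 ≤ S.det := by
  set P := S.map Complex.ofReal with hPdef
  set H := Complex.I • Omega4.map Complex.ofReal with hHdef
  have hPT : Pᵀ = P := by rw [hPdef, ← transpose_map, hS.eq]
  have hHT : Hᵀ = -H := by
    rw [hHdef, transpose_smul, ← transpose_map, transpose_Omega4]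
    ext
    simp
  have hP : P.IsHermitian := by
    ext i j
    simp [hPdef, hS.apply]
  have hH : H.IsHermitian := by
    simpa using h.isHermitian.sub hP
  have hsub : (P - H).PosSemidef := by
    simpa [transpose_add, hPT, hHT, sub_eq_add_neg] using h.transpose
  have hHdet : H.det = 1 := by
    have hdet : (Omega4.map Complex.ofReal).det = (Omega4.det : ℂ) :=
      (Complex.ofRealHom.map_det Omega4).symm
    rw [hHdef, det_smul, hdet, det_Omega4]
    simp
  have hPdet : P.det = (S.det : ℂ) := (Complex.ofRealHom.map_det S).symm
  have hPD : P.PosDef := posDef_of_posSemidef_add_of_posSemidef_sub hP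
    ((isUnit_iff_isUnit_det H).mpr (by simp [hHdet])) h hsub
  have hle := hPD.norm_det_le hH h hsub
  have hpos := hPD.det_pos
  rw [hPdet, Complex.zero_lt_real] at hpos
  rwa [hHdet, hPdet, norm_one, Complex.norm_real, Real.norm_of_nonneg hpos.le] at hle

theorem det_fin_two_sum_fin_two {R : Type*} [CommRing R]
    (A : Matrix (Fin 2 ⊕ Fin 2) (Fin 2 ⊕ Fin 2) R) :
    A.det =
      !![A (.inl 0) (.inl 0), A (.inl 0) (.inl 1), A (.inl 0) (.inr 0), A (.inl 0) (.inr 1);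
         A (.inl 1) (.inl 0), A (.inl 1) (.inl 1), A (.inl 1) (.inr 0), A (.inl 1) (.inr 1);
         A (.inr 0) (.inl 0), A (.inr 0) (.inl 1), A (.inr 0) (.inr 0), A (.inr 0) (.inr 1);
         A (.inr 1) (.inl 0), A (.inr 1) (.inl 1), A (.inr 1) (.inr 0), A (.inr 1) (.inr 1)].det := by
  rw [← det_submatrix_equiv_self (finSumFinEquiv (m := 2) (n := 2)).symm A]
  congr 1
  ext i j
  fin_cases i <;> fin_cases j <;> rfl

theorem det_add_I_smul_Omega4 (γA γB γAB : Matrix (Fin 2) (Fin 2) ℝ)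
    (hA : γA.IsSymm) (hB : γB.IsSymm) :
    ((fromBlocks γA γAB γABᵀ γB).map Complex.ofReal
        + Complex.I • Omega4.map Complex.ofReal).det =
      ((1 + (fromBlocks γA γAB γABᵀ γB).det - (γA.det + γB.det + 2 * γAB.det) : ℝ) : ℂ) := by
  have hA' := hA.apply 0 1
  have hB' := hB.apply 0 1
  rw [det_fin_two_sum_fin_two, det_fin_two_sum_fin_two]
  simp [det_succ_row_zero, Fin.sum_univ_succ, Fin.succAbove, Omega4, omega2, hA', hB']
  linear_combination ((γA 0 0 : ℂ) * γA 1 1 - (γA 0 1 : ℂ) ^ 2 + γB 0 0 * γB 1 1 -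
    (γB 0 1 : ℂ) ^ 2 + 2 * (γAB 0 0 * γAB 1 1 - γAB 0 1 * γAB 1 0) + Complex.I ^ 2 - 1) *
      Complex.I_sq

/-- Two-mode Robertson–Schrödinger uncertainty relation in scalar form:
for a symmetric Σ = [[γ_A, γ_AB],[γ_ABᵀ, γ_B]] with Σ + iΩ ⪰ 0, one has
det Σ ≥ 1 and Δ = det γ_A + det γ_B + 2 det γ_AB ≤ 1 + det Σ. -/
theorem two_mode_uncertainty (γA γB γAB : Matrix (Fin 2) (Fin 2) ℝ)
    (hA : γA.IsSymm) (hB : γB.IsSymm)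
    (h : ((Matrix.fromBlocks γA γAB γABᵀ γB).map Complex.ofReal
        + Complex.I • Omega4.map Complex.ofReal).PosSemidef) :
    1 ≤ (Matrix.fromBlocks γA γAB γABᵀ γB).det ∧
    γA.det + γB.det + 2 * γAB.det ≤ 1 + (Matrix.fromBlocks γA γAB γABᵀ γB).det := by
  refine ⟨one_le_det_of_posSemidef (.fromBlocks hA rfl hB) h, ?_⟩
  have hdet := h.det_nonneg
  rw [det_add_I_smul_Omega4 γA γB γAB hA hB, Complex.zero_le_real] at hdet
  linarith
end

section
/- Let Σ be a real symmetric 4×4 matrix written in 2×2 blocks as Σ = [[γ_A, γ_AB],[γ_ABᵀ, γ_B]], let Ω = ω ⊕ ω with ω = [[0,1],[-1,0]], and set Δ = det γ_A + det γ_B + 2 det γ_AB and Γ = det Σ. Then for every scalar x, det(x·I₄ − Ω Σ) = x⁴ + Δ x² + Γ; equivalently, the eigenvalues of iΩΣ come in pairs ±ν₁, ±ν₂ with ν₁² + ν₂² = Δ and ν₁²ν₂² = Γ. -/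
open Matrix

/-- The determinant of a 4×4 matrix in 2×2 blocks, as the determinant of the array of entries. -/
theorem det_fromBlocks_fin_two {R : Type*} [CommRing R] (A B C D : Matrix (Fin 2) (Fin 2) R) :
    (Matrix.fromBlocks A B C D).det =
      !![A 0 0, A 0 1, B 0 0, B 0 1;
         A 1 0, A 1 1, B 1 0, B 1 1;
         C 0 0, C 0 1, D 0 0, D 0 1;
         C 1 0, C 1 1, D 1 0, D 1 1].det := by
  rw [← Matrix.det_submatrix_equiv_self (finSumFinEquiv (m := 2) (n := 2)).symm]
  congr 1
  ext i j
  fin_cases i <;> fin_cases j <;> rfl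

/-- For a symmetric two-mode covariance matrix Σ = [[γ_A, γ_AB],[γ_ABᵀ, γ_B]],
with Δ = det γ_A + det γ_B + 2 det γ_AB and Γ = det Σ, one has
det(x I₄ − Ω Σ) = x⁴ + Δ x² + Γ for every scalar x. -/
theorem two_mode_symplectic_charpoly (γA γB γAB : Matrix (Fin 2) (Fin 2) ℝ)
    (hA : γA.IsSymm) (hB : γB.IsSymm) (x : ℝ) :
    (x • (1 : Matrix (Fin 2 ⊕ Fin 2) (Fin 2 ⊕ Fin 2) ℝ)
        - Omega4 * Matrix.fromBlocks γA γAB γABᵀ γB).det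
      = x ^ 4 + (γA.det + γB.det + 2 * γAB.det) * x ^ 2
          + (Matrix.fromBlocks γA γAB γABᵀ γB).det := by
  have hA' : γA 1 0 = γA 0 1 := hA.apply 0 1
  have hB' : γB 1 0 = γB 0 1 := hB.apply 0 1
  rw [← Matrix.fromBlocks_one, Matrix.fromBlocks_smul, Omega4, Matrix.fromBlocks_multiply,
    sub_eq_add_neg, Matrix.fromBlocks_neg, Matrix.fromBlocks_add, det_fromBlocks_fin_two,
    det_fromBlocks_fin_two]
  simp [omega2, Matrix.det_succ_row_zero, Fin.sum_univ_succ, Matrix.vecMul, dotProduct,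
    Fin.succAbove, hA', hB']
  ring
end
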